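/- arXiv:1012.1057 — 7 statements merged into one kernel-verified Lean document; each statement's English description precedes it below -/
import Mathlib

section
/- Let L > 0, T > 0 and let v, f : ℝ × ℝ → ℝ be smooth functions such that v_t + v_x + v_xxx = f on [0,L] × [0,T] and v(0,t) = 0, v_x(L,t) = 0, v_xx(L,t) = 0 for all t ∈ [0,T]. Then for every t ∈ [0,T], (d/dt) ∫₀^L v(x,t)² dx + v(L,t)² + v_x(0,t)² = 2 ∫₀^L f(x,t) v(x,t) dx. -/
open MeasureTheory Set

theorem energy_identity_linear_forced
    (L T : ℝ) (hL : 0 < L) (hT : 0 < T)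
    (v f : ℝ → ℝ → ℝ)
    (hv : ContDiff ℝ (⊤ : ℕ∞) (Function.uncurry v))
    (hf : ContDiff ℝ (⊤ : ℕ∞) (Function.uncurry f))
    (heq : ∀ x ∈ Icc (0:ℝ) L, ∀ t ∈ Icc (0:ℝ) T,
      deriv (fun s => v x s) t + deriv (fun y => v y t) x
        + iteratedDeriv 3 (fun y => v y t) x = f x t)
    (hbc : ∀ t ∈ Icc (0:ℝ) T,
      v 0 t = 0 ∧ deriv (fun y => v y t) L = 0
        ∧ iteratedDeriv 2 (fun y => v y t) L = 0) :
    ∀ t ∈ Icc (0:ℝ) T,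
      deriv (fun s => ∫ x in (0:ℝ)..L, (v x s)^2) t
        + (v L t)^2 + (deriv (fun y => v y t) 0)^2
      = 2 * ∫ x in (0:ℝ)..L, f x t * v x t := by
  intro t ht
  obtain ⟨b0, b1, b2⟩ := hbc t ht
  set w : ℝ → ℝ → ℝ := fun x s => fderiv ℝ (Function.uncurry v) (x, s) (0, 1) with hw
  have hwc : Continuous (Function.uncurry w) := by
    have h1 : Continuous (fderiv ℝ (Function.uncurry v)) := hv.continuous_fderiv (by simp)
    exact h1.clm_apply continuous_const
  have hvc : Continuous (Function.uncurry v) := hv.continuous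
  have hfc : Continuous (Function.uncurry f) := hf.continuous
  have hwd : ∀ x s, HasDerivAt (fun s => v x s) (w x s) s := by
    intro x s
    have h1 : HasFDerivAt (Function.uncurry v) (fderiv ℝ (Function.uncurry v) (x, s)) (x, s) :=
      (hv.differentiable (by simp) (x, s)).hasFDerivAt
    have h2 : HasDerivAt (fun s : ℝ => (x, s)) ((0 : ℝ), (1 : ℝ)) s :=
      (hasDerivAt_const s x).prodMk (hasDerivAt_id s)
    exact h1.comp_hasDerivAt s h2
  have hgc : Continuous (fun p : ℝ × ℝ => 2 * v p.1 p.2 * w p.1 p.2) :=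
    (continuous_const.mul hvc).mul hwc
  obtain ⟨C, hC⟩ := ((isCompact_Icc (a := (0:ℝ)) (b := L)).prod
    (isCompact_Icc (a := t - 1) (b := t + 1))).exists_bound_of_continuousOn hgc.continuousOn
  have hvx : ∀ s, Continuous (fun x => v x s) := fun s =>
    hvc.comp (continuous_id.prodMk continuous_const)
  have hwx : ∀ s, Continuous (fun x => w x s) := fun s =>
    hwc.comp (continuous_id.prodMk continuous_const)
  have hfx : Continuous (fun x => f x t) := hfc.comp (continuous_id.prodMk continuous_const)
  have hD : HasDerivAt (fun s => ∫ x in (0:ℝ)..L, (v x s)^2)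
      (∫ x in (0:ℝ)..L, 2 * v x t * w x t) t := by
    refine (intervalIntegral.hasDerivAt_integral_of_dominated_loc_of_deriv_le
      (F := fun s x => (v x s)^2) (F' := fun s x => 2 * v x s * w x s)
      (s := Icc (t-1) (t+1)) (bound := fun _ => C)
      (Icc_mem_nhds (by linarith) (by linarith)) ?_ ?_ ?_ ?_ ?_ ?_).2
    · exact Filter.Eventually.of_forall fun s => ((hvx s).pow 2).aestronglyMeasurable
    · exact ((hvx t).pow 2).intervalIntegrable _ _
    · exact ((continuous_const.mul (hvx t)).mul (hwx t)).aestronglyMeasurable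
    · refine Filter.Eventually.of_forall fun x hx s hs => ?_
      rw [uIoc_of_le hL.le] at hx
      exact hC (x, s) ⟨⟨hx.1.le, hx.2⟩, hs⟩
    · exact intervalIntegrable_const
    · refine Filter.Eventually.of_forall fun x _ s _ => ?_
      have := (hwd x s).pow 2
      exact this.congr_deriv (by simp)
  rw [hD.deriv]
  set u : ℝ → ℝ := fun y => v y t with hu
  have huC : ContDiff ℝ (⊤ : ℕ∞) u := hv.comp (contDiff_id.prodMk contDiff_const)
  have hd : ∀ n x, HasDerivAt (iteratedDeriv n u) (iteratedDeriv (n+1) u x) x := by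
    intro n x
    rw [iteratedDeriv_succ]
    exact (huC.differentiable_iteratedDeriv n (by exact_mod_cast WithTop.coe_lt_top n) x).hasDerivAt
  have hcont : ∀ n, Continuous (iteratedDeriv n u) := fun n =>
    continuous_iff_continuousAt.2 fun x => (hd n x).continuousAt
  have d0 : ∀ x, HasDerivAt u (deriv u x) x := fun x => by
    simpa [iteratedDeriv_one] using hd 0 x
  have d1 : ∀ x, HasDerivAt (deriv u) (iteratedDeriv 2 u x) x := fun x => by
    have := hd 1 x
    rwa [iteratedDeriv_one] at this
  have c1 : Continuous (deriv u) := by simpa [iteratedDeriv_one] using hcont 1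
  have c0 : Continuous u := hvx t
  have c3 := hcont 3
  have hF : ∀ x, HasDerivAt (fun x => u x ^ 2 + 2 * (u x * iteratedDeriv 2 u x) - deriv u x ^ 2)
      (2 * u x * deriv u x + 2 * u x * iteratedDeriv 3 u x) x := by
    intro x
    have := (((d0 x).pow 2).add (((d0 x).mul (hd 2 x)).const_mul 2)).sub ((d1 x).pow 2)
    refine this.congr_deriv ?_
    norm_num
    ring
  have hI : ∫ x in (0:ℝ)..L, (2 * u x * deriv u x + 2 * u x * iteratedDeriv 3 u x)
      = u L ^ 2 + deriv u 0 ^ 2 := by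
    rw [intervalIntegral.integral_eq_sub_of_hasDerivAt (fun x _ => hF x)
      (Continuous.intervalIntegrable (by fun_prop) _ _)]
    have b0' : u 0 = 0 := b0
    rw [b0', b1, b2]
    ring
  have hS : (∫ x in (0:ℝ)..L, 2 * v x t * w x t)
      + ∫ x in (0:ℝ)..L, (2 * u x * deriv u x + 2 * u x * iteratedDeriv 3 u x)
      = ∫ x in (0:ℝ)..L, 2 * (f x t * v x t) := by
    have i1 : IntervalIntegrable (fun x => 2 * v x t * w x t) volume 0 L :=
      ((continuous_const.mul (hvx t)).mul (hwx t)).intervalIntegrable _ _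
    have i2 : IntervalIntegrable (fun x => 2 * u x * deriv u x + 2 * u x * iteratedDeriv 3 u x)
        volume 0 L := Continuous.intervalIntegrable (by fun_prop) _ _
    rw [← intervalIntegral.integral_add i1 i2]
    refine intervalIntegral.integral_congr fun x hx => ?_
    rw [uIcc_of_le hL.le] at hx
    have h := heq x hx t ht
    rw [(hwd x t).deriv] at h
    simp only [← h, hu]
    ring
  rw [hI, intervalIntegral.integral_const_mul] at hS
  rw [← hS]
  ring
end

section
/- Let L > 0, T > 0 and let v, f : ℝ × ℝ → ℝ be smooth functions such that v_t + v_x + v_xxx = f on [0,L] × [0,T] and v(0,t) = 0, v_x(L,t) = 0, v_xx(L,t) = 0 for all t ∈ [0,T]. Then for every t ∈ [0,T], (d/dt) ∫₀^L x v(x,t)² dx + L v(L,t)² + 3 ∫₀^L v_x(x,t)² dx = ∫₀^L v(x,t)² dx + 2 ∫₀^L x f(x,t) v(x,t) dx. -/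
open MeasureTheory Set

theorem weighted_energy_identity_linear_forced
    (L T : ℝ) (hL : 0 < L) (hT : 0 < T)
    (v f : ℝ → ℝ → ℝ)
    (hv : ContDiff ℝ (⊤ : ℕ∞) (Function.uncurry v))
    (hf : ContDiff ℝ (⊤ : ℕ∞) (Function.uncurry f))
    (heq : ∀ x ∈ Icc (0:ℝ) L, ∀ t ∈ Icc (0:ℝ) T,
      deriv (fun s => v x s) t + deriv (fun y => v y t) x
        + iteratedDeriv 3 (fun y => v y t) x = f x t)
    (hbc : ∀ t ∈ Icc (0:ℝ) T,
      v 0 t = 0 ∧ deriv (fun y => v y t) L = 0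
        ∧ iteratedDeriv 2 (fun y => v y t) L = 0) :
    ∀ t ∈ Icc (0:ℝ) T,
      deriv (fun s => ∫ x in (0:ℝ)..L, x * (v x s)^2) t
        + L * (v L t)^2 + 3 * ∫ x in (0:ℝ)..L, (deriv (fun y => v y t) x)^2
      = (∫ x in (0:ℝ)..L, (v x t)^2)
        + 2 * ∫ x in (0:ℝ)..L, x * f x t * v x t := by
  intro t ht
  obtain ⟨hb0, hb1, hb2⟩ := hbc t ht
  have hvc : Continuous (fun p : ℝ × ℝ => v p.1 p.2) := hv.continuous
  have hfc : Continuous (fun x => f x t) :=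
    hf.continuous.comp (Continuous.prodMk_left t)
  -- time derivative
  let D : ℝ → ℝ → ℝ := fun x s => fderiv ℝ (Function.uncurry v) (x, s) (0, 1)
  have hDc : Continuous (fun p : ℝ × ℝ => D p.1 p.2) :=
    (hv.continuous_fderiv (by simp)).clm_apply continuous_const
  have hD : ∀ x s, HasDerivAt (fun s => v x s) (D x s) s := by
    intro x s
    have h1 : HasFDerivAt (Function.uncurry v) (fderiv ℝ (Function.uncurry v) (x, s)) (x, s) :=
      (hv.differentiable (by simp) (x, s)).hasFDerivAt
    have h2 : HasDerivAt (fun s : ℝ => (x, s)) ((0 : ℝ), (1 : ℝ)) s :=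
      (hasDerivAt_const s x).prodMk (hasDerivAt_id s)
    exact h1.comp_hasDerivAt s h2
  -- space derivatives
  have hw : ContDiff ℝ (⊤ : ℕ∞) (fun y => v y t) :=
    hv.comp (contDiff_id.prodMk contDiff_const)
  have hwk : ∀ k : ℕ, Continuous (iteratedDeriv k (fun y => v y t)) := fun k =>
    hw.continuous_iteratedDeriv k (by exact_mod_cast le_top)
  have hwd : ∀ (k : ℕ) x, HasDerivAt (iteratedDeriv k (fun y => v y t))
      (iteratedDeriv (k+1) (fun y => v y t) x) x := by
    intro k x
    rw [iteratedDeriv_succ]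
    exact (hw.differentiable_iteratedDeriv k
      (by exact_mod_cast ENat.coe_lt_top k) x).hasDerivAt
  have h0 := hwd 0
  have h1 := hwd 1
  have h2 := hwd 2
  have c1 := hwk 1
  have c2 := hwk 2
  have c3 := hwk 3
  simp only [iteratedDeriv_zero, zero_add, Nat.reduceAdd, iteratedDeriv_one] at h0 h1 h2 c1
  have c0 : Continuous (fun y => v y t) := hw.continuous
  have hder : HasDerivAt (fun s => ∫ x in (0:ℝ)..L, x * (v x s)^2)
      (∫ x in (0:ℝ)..L, x * (2 * v x t * D x t)) t := by
    have hFc : Continuous (fun p : ℝ × ℝ => p.1 * (2 * v p.1 p.2 * D p.1 p.2)) := by fun_prop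
    obtain ⟨C, hC⟩ := ((isCompact_Icc (a := (0:ℝ)) (b := L)).prod
      (isCompact_Icc (a := t - 1) (b := t + 1))).exists_bound_of_continuousOn hFc.continuousOn
    refine (intervalIntegral.hasDerivAt_integral_of_dominated_loc_of_deriv_le
      (F := fun s x => x * (v x s)^2) (F' := fun s x => x * (2 * v x s * D x s))
      (bound := fun _ => C) (s := Icc (t-1) (t+1))
      (Icc_mem_nhds (by linarith) (by linarith)) ?_ ?_ ?_ ?_ ?_ ?_).2
    · refine Filter.Eventually.of_forall fun s => ?_
      have : Continuous (fun x => v x s) := hvc.comp (Continuous.prodMk_left s)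
      exact Continuous.aestronglyMeasurable (by fun_prop)
    · exact Continuous.intervalIntegrable (by fun_prop) _ _
    · exact (hFc.comp (Continuous.prodMk_left t)).aestronglyMeasurable
    · refine Filter.Eventually.of_forall fun x hx s hs => ?_
      rw [uIoc_of_le hL.le] at hx
      exact hC (x, s) ⟨⟨hx.1.le, hx.2⟩, hs⟩
    · exact intervalIntegrable_const
    · refine Filter.Eventually.of_forall fun x hx s hs => ?_
      have := ((hD x s).pow 2).const_mul x
      simpa using this
  rw [hder.deriv]
  have hftc : ∫ x in (0:ℝ)..L, ((v x t)^2 + 2 * (x * f x t * v x t)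
      - x * (2 * v x t * D x t) - 3 * (deriv (fun y => v y t) x)^2) = L * (v L t)^2 := by
    have hP := intervalIntegral.integral_eq_sub_of_hasDerivAt (a := 0) (b := L)
      (f := fun x => x * (v x t)^2 + 2 * x * v x t * iteratedDeriv 2 (fun y => v y t) x
        - x * (deriv (fun y => v y t) x)^2 - 2 * v x t * deriv (fun y => v y t) x)
      (f' := fun x => (v x t)^2 + 2 * x * v x t * deriv (fun y => v y t) x
        + 2 * x * v x t * iteratedDeriv 3 (fun y => v y t) x
        - 3 * (deriv (fun y => v y t) x)^2) ?_ ?_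
    · rw [hb0, hb1, hb2] at hP
      rw [intervalIntegral.integral_congr (g := fun x => (v x t)^2
        + 2 * x * v x t * deriv (fun y => v y t) x
        + 2 * x * v x t * iteratedDeriv 3 (fun y => v y t) x
        - 3 * (deriv (fun y => v y t) x)^2), hP]
      · ring
      · intro x hx
        rw [uIcc_of_le hL.le] at hx
        have := heq x hx t ht
        rw [(hD x t).deriv] at this
        simp only
        rw [← this]
        ring
    · intro x _
      have hx := hasDerivAt_id' x
      have := (((hx.mul ((h0 x).pow 2)).add (((hx.const_mul 2).mul (h0 x)).mul (h2 x))).sub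
        (hx.mul ((h1 x).pow 2))).sub (((h0 x).const_mul 2).mul (h1 x))
      refine this.congr_deriv ?_
      simp only [Pi.mul_apply, Pi.pow_apply]
      push_cast
      ring
    · exact Continuous.intervalIntegrable (by fun_prop) _ _
  have cD : Continuous (fun x => D x t) := hDc.comp (Continuous.prodMk_left t)
  have i1 : IntervalIntegrable (fun x => (v x t)^2) volume 0 L :=
    Continuous.intervalIntegrable (by fun_prop) _ _
  have i2 : IntervalIntegrable (fun x => 2 * (x * f x t * v x t)) volume 0 L :=
    Continuous.intervalIntegrable (by fun_prop) _ _
  have i3 : IntervalIntegrable (fun x => x * (2 * v x t * D x t)) volume 0 L :=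
    Continuous.intervalIntegrable (by fun_prop) _ _
  have i4 : IntervalIntegrable (fun x => 3 * (deriv (fun y => v y t) x)^2) volume 0 L :=
    Continuous.intervalIntegrable (by fun_prop) _ _
  rw [intervalIntegral.integral_sub ((i1.add i2).sub i3) i4,
    intervalIntegral.integral_sub (i1.add i2) i3, intervalIntegral.integral_add i1 i2,
    intervalIntegral.integral_const_mul, intervalIntegral.integral_const_mul] at hftc
  linarith
end

section
/- Let L > 0 and T > 0. There exists a constant C > 0, depending only on L and T, such that for every smooth function v : ℝ × ℝ → ℝ satisfying v(0,t) = 0, v_x(L,t) = 0, v_xx(L,t) = 0 for all t ∈ [0,T], with f := v_t + v_x + v_xxx, one has sup_{t ∈ [0,T]} (∫₀^L v(x,t)² dx)^{1/2} + (∫₀^T ∫₀^L v_x(x,t)² dx dt)^{1/2} ≤ C [ (∫₀^L v(x,0)² dx)^{1/2} + ∫₀^T (∫₀^L f(x,t)² dx)^{1/2} dt ]. -/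
open MeasureTheory Set

lemma partial_aux (v : ℝ → ℝ → ℝ) (hv : ContDiff ℝ (⊤ : ℕ∞) (Function.uncurry v)) :
    ContDiff ℝ (⊤ : ℕ∞) (Function.uncurry (fun x t => deriv (fun y => v y t) x)) ∧
    (∀ x t, HasDerivAt (fun y => v y t) (deriv (fun y => v y t) x) x) ∧
    ContDiff ℝ (⊤ : ℕ∞) (Function.uncurry (fun x t => deriv (fun s => v x s) t)) ∧
    (∀ x t, HasDerivAt (fun s => v x s) (deriv (fun s => v x s) t) t) := by
  have hd : Differentiable ℝ (Function.uncurry v) := hv.differentiable (by simp)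
  have h1 : ∀ x t, HasDerivAt (fun y => v y t) (fderiv ℝ (Function.uncurry v) (x,t) (1,0)) x := by
    intro x t
    exact (hd (x,t)).hasFDerivAt.comp_hasDerivAt x
      ((hasDerivAt_id x).prodMk (hasDerivAt_const x t))
  have h2 : ∀ x t, HasDerivAt (fun s => v x s) (fderiv ℝ (Function.uncurry v) (x,t) (0,1)) t := by
    intro x t
    exact (hd (x,t)).hasFDerivAt.comp_hasDerivAt t
      ((hasDerivAt_const t x).prodMk (hasDerivAt_id t))
  have hf : ContDiff ℝ (⊤ : ℕ∞) (fderiv ℝ (Function.uncurry v)) :=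
    hv.fderiv_right (by simp)
  refine ⟨?_, fun x t => (h1 x t).differentiableAt.hasDerivAt, ?_,
    fun x t => (h2 x t).differentiableAt.hasDerivAt⟩
  · have : Function.uncurry (fun x t => deriv (fun y => v y t) x)
        = fun p => fderiv ℝ (Function.uncurry v) p (1,0) := by
      ext ⟨x,t⟩; exact (h1 x t).deriv
    rw [this]; exact hf.clm_apply contDiff_const
  · have : Function.uncurry (fun x t => deriv (fun s => v x s) t)
        = fun p => fderiv ℝ (Function.uncurry v) p (0,1) := by
      ext ⟨x,t⟩; exact (h2 x t).deriv
    rw [this]; exact hf.clm_apply contDiff_const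

lemma cs_aux (L : ℝ) (hL : 0 < L) (u g : ℝ → ℝ) (hu : Continuous u) (hg : Continuous g) :
    ∫ x in (0:ℝ)..L, u x * g x ≤
      Real.sqrt (∫ x in (0:ℝ)..L, u x ^ 2) * Real.sqrt (∫ x in (0:ℝ)..L, g x ^ 2) := by
  have h : ∀ s : ℝ, 0 ≤ (∫ x in (0:ℝ)..L, g x ^ 2) * (s * s)
      + (2 * ∫ x in (0:ℝ)..L, u x * g x) * s + ∫ x in (0:ℝ)..L, u x ^ 2 := by
    intro s
    have h0 : 0 ≤ ∫ x in (0:ℝ)..L, (u x + s * g x) ^ 2 :=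
      intervalIntegral.integral_nonneg hL.le (fun x _ => sq_nonneg _)
    have h1 : ∫ x in (0:ℝ)..L, (u x + s * g x) ^ 2 = ∫ x in (0:ℝ)..L,
        ((s * s) * g x ^ 2 + (2 * s) * (u x * g x) + u x ^ 2) := by
      congr 1; ext x; ring
    rw [h1, intervalIntegral.integral_add, intervalIntegral.integral_add,
      intervalIntegral.integral_const_mul, intervalIntegral.integral_const_mul] at h0
    · linarith
    all_goals exact Continuous.intervalIntegrable (by fun_prop) _ _
  have hd := discrim_le_zero h
  rw [← Real.sqrt_mul (intervalIntegral.integral_nonneg hL.le (fun x _ => sq_nonneg _))]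
  apply Real.le_sqrt_of_sq_le
  unfold discrim at hd
  nlinarith

lemma space_aux (L a b : ℝ) (hL : 0 < L) (ha : 0 ≤ a) (hb : 0 ≤ b) (u u1 u2 u3 : ℝ → ℝ)
    (h0 : ∀ x, HasDerivAt u (u1 x) x) (h1 : ∀ x, HasDerivAt u1 (u2 x) x)
    (h2 : ∀ x, HasDerivAt u2 (u3 x) x) (h3 : Continuous u3)
    (b0 : u 0 = 0) (b1 : u1 L = 0) (b2 : u2 L = 0) :
    3 * b / 2 * (∫ x in (0:ℝ)..L, u1 x ^ 2) - b / 2 * (∫ x in (0:ℝ)..L, u x ^ 2) ≤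
      ∫ x in (0:ℝ)..L, (a + b * x) * u x * (u1 x + u3 x) := by
  have c0 : Continuous u := continuous_iff_continuousAt.2 fun x => (h0 x).continuousAt
  have c1 : Continuous u1 := continuous_iff_continuousAt.2 fun x => (h1 x).continuousAt
  have hG : ∀ x, HasDerivAt (fun x => (a + b * x) * (u x ^ 2 / 2 + u x * u2 x - u1 x ^ 2 / 2)
      - b * (u x * u1 x)) ((a + b * x) * u x * (u1 x + u3 x) - 3 * b / 2 * u1 x ^ 2
        + b / 2 * u x ^ 2) x := by
    intro x
    have := (((hasDerivAt_id x).const_mul b).const_add a).mul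
      (((((h0 x).pow 2).div_const 2).add ((h0 x).mul (h2 x))).sub (((h1 x).pow 2).div_const 2))
    have := this.sub (((h0 x).mul (h1 x)).const_mul b)
    refine this.congr_deriv ?_
    simp
    ring
  have := intervalIntegral.integral_eq_sub_of_hasDerivAt (a := 0) (b := L) (fun x _ => hG x)
    (Continuous.intervalIntegrable (by fun_prop) _ _)
  rw [intervalIntegral.integral_add, intervalIntegral.integral_sub,
      intervalIntegral.integral_const_mul, intervalIntegral.integral_const_mul, b0, b1, b2] at this
  · have p1 : 0 ≤ (a + b * L) * u L ^ 2 := by positivity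
    have p2 : 0 ≤ a * u1 0 ^ 2 := by positivity
    linarith
  all_goals exact Continuous.intervalIntegrable (by fun_prop) _ _

lemma energy_aux (L T a b M : ℝ) (hL : 0 < L) (ha : 0 ≤ a) (hb : 0 ≤ b)
    (v v1 v2 v3 vt : ℝ → ℝ → ℝ)
    (c0 : Continuous (Function.uncurry v)) (c1 : Continuous (Function.uncurry v1))
    (c3 : Continuous (Function.uncurry v3)) (ct : Continuous (Function.uncurry vt))
    (h0 : ∀ x t, HasDerivAt (fun y => v y t) (v1 x t) x)
    (h1 : ∀ x t, HasDerivAt (fun y => v1 y t) (v2 x t) x)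
    (h2 : ∀ x t, HasDerivAt (fun y => v2 y t) (v3 x t) x)
    (ht : ∀ x t, HasDerivAt (fun s => v x s) (vt x t) t)
    (hbc : ∀ t ∈ Icc (0:ℝ) T, v 0 t = 0 ∧ v1 L t = 0 ∧ v2 L t = 0)
    (f : ℝ → ℝ → ℝ) (hf : ∀ x t, f x t = vt x t + v1 x t + v3 x t)
    (hM : ∀ t ∈ Icc (0:ℝ) T, Real.sqrt (∫ x in (0:ℝ)..L, v x t ^ 2) ≤ M)
    (τ : ℝ) (hτ : τ ∈ Icc (0:ℝ) T) :
    (∫ x in (0:ℝ)..L, (a + b * x) * v x τ ^ 2) / 2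
      - (∫ x in (0:ℝ)..L, (a + b * x) * v x 0 ^ 2) / 2
      + 3 * b / 2 * (∫ t in (0:ℝ)..τ, ∫ x in (0:ℝ)..L, v1 x t ^ 2) ≤
    b / 2 * M ^ 2 * τ + (a + b * L) * M *
      ∫ t in (0:ℝ)..τ, Real.sqrt (∫ x in (0:ℝ)..L, f x t ^ 2) := by
  have cf : Continuous (Function.uncurry f) := by
    have : Function.uncurry f = fun p => Function.uncurry vt p + Function.uncurry v1 p
      + Function.uncurry v3 p := by ext ⟨x, t⟩; exact hf x t
    rw [this]; fun_prop
  have hM0 : 0 ≤ M := (Real.sqrt_nonneg _).trans (hM τ hτ)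
  have cc0 : Continuous fun p : ℝ × ℝ => v p.1 p.2 := c0
  have cc1 : Continuous fun p : ℝ × ℝ => v1 p.1 p.2 := c1
  have cc3 : Continuous fun p : ℝ × ℝ => v3 p.1 p.2 := c3
  have cct : Continuous fun p : ℝ × ℝ => vt p.1 p.2 := ct
  have ccf : Continuous fun p : ℝ × ℝ => f p.1 p.2 := cf
  have sx : ∀ w : ℝ → ℝ → ℝ, Continuous (fun p : ℝ × ℝ => w p.1 p.2) →
      ∀ t, Continuous fun x => w x t := fun w hw t =>
    hw.comp (continuous_id.prodMk continuous_const)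
  have st : ∀ w : ℝ → ℝ → ℝ, Continuous (fun p : ℝ × ℝ => w p.1 p.2) →
      ∀ x, Continuous fun t => w x t := fun w hw x =>
    hw.comp (continuous_const.prodMk continuous_id)
  have ip : ∀ w : ℝ → ℝ → ℝ, Continuous (fun p : ℝ × ℝ => w p.1 p.2) →
      Continuous fun t => ∫ x in (0:ℝ)..L, w x t := fun w hw =>
    intervalIntegral.continuous_parametric_intervalIntegral_of_continuous'
      (f := fun t x => w x t) (hw.comp continuous_swap) 0 L
  have pt : ∀ t ∈ Icc (0:ℝ) τ, (∫ x in (0:ℝ)..L, (a + b * x) * v x t * vt x t)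
      + 3 * b / 2 * (∫ x in (0:ℝ)..L, v1 x t ^ 2) ≤
      b / 2 * M ^ 2 + (a + b * L) * M * Real.sqrt (∫ x in (0:ℝ)..L, f x t ^ 2) := by
    intro t ht'
    have htT : t ∈ Icc (0:ℝ) T := ⟨ht'.1, ht'.2.trans hτ.2⟩
    obtain ⟨e0, e1, e2⟩ := hbc t htT
    have k0 := sx v cc0 t
    have k1 := sx v1 cc1 t
    have k3 := sx v3 cc3 t
    have kt := sx vt cct t
    have kf := sx f ccf t
    have hs := space_aux L a b hL ha hb (fun x => v x t) (fun x => v1 x t) (fun x => v2 x t)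
      (fun x => v3 x t) (fun x => h0 x t) (fun x => h1 x t) (fun x => h2 x t) k3 e0 e1 e2
    have hc := cs_aux L hL (fun x => (a + b * x) * v x t) (fun x => f x t) (by fun_prop) kf
    have hsum : ∫ x in (0:ℝ)..L, (a + b * x) * v x t * f x t
        = (∫ x in (0:ℝ)..L, (a + b * x) * v x t * vt x t)
          + ∫ x in (0:ℝ)..L, (a + b * x) * v x t * (v1 x t + v3 x t) := by
      rw [← intervalIntegral.integral_add]
      · congr 1; ext x; rw [hf]; ring
      all_goals exact Continuous.intervalIntegrable (by fun_prop) _ _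
    have hn : 0 ≤ ∫ x in (0:ℝ)..L, v x t ^ 2 :=
      intervalIntegral.integral_nonneg hL.le (fun x _ => sq_nonneg _)
    have hw : Real.sqrt (∫ x in (0:ℝ)..L, ((a + b * x) * v x t) ^ 2) ≤ (a + b * L) * M := by
      have h1 : ∫ x in (0:ℝ)..L, ((a + b * x) * v x t) ^ 2 ≤
          (a + b * L) ^ 2 * ∫ x in (0:ℝ)..L, v x t ^ 2 := by
        rw [← intervalIntegral.integral_const_mul]
        apply intervalIntegral.integral_mono_on hL.le
        · exact Continuous.intervalIntegrable (by fun_prop) _ _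
        · exact Continuous.intervalIntegrable (by fun_prop) _ _
        · intro x hx
          rw [mul_pow]
          have := hx.1
          have := hx.2
          gcongr
      calc _ ≤ Real.sqrt ((a + b * L) ^ 2 * ∫ x in (0:ℝ)..L, v x t ^ 2) := Real.sqrt_le_sqrt h1
        _ = (a + b * L) * Real.sqrt (∫ x in (0:ℝ)..L, v x t ^ 2) := by
          rw [Real.sqrt_mul (sq_nonneg _), Real.sqrt_sq (by positivity)]
        _ ≤ _ := by gcongr; exact hM t htT
    have hy : ∫ x in (0:ℝ)..L, v x t ^ 2 ≤ M ^ 2 := (Real.sqrt_le_left hM0).1 (hM t htT)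
    have hc2 := hc.trans (mul_le_mul_of_nonneg_right hw (Real.sqrt_nonneg _))
    have hy2 := mul_le_mul_of_nonneg_left hy (show 0 ≤ b / 2 by positivity)
    beta_reduce at hc2 hs
    linarith
  have ca := ip (fun x t => (a + b * x) * v x t * vt x t) (by fun_prop)
  have cb := ip (fun x t => v1 x t ^ 2) (by fun_prop)
  have cg := ip (fun x t => f x t ^ 2) (by fun_prop)
  have hI := intervalIntegral.integral_mono_on (μ := volume) hτ.1
    (Continuous.intervalIntegrable (by fun_prop) _ _)
    (Continuous.intervalIntegrable (by fun_prop) _ _) pt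
  rw [intervalIntegral.integral_add, intervalIntegral.integral_add,
    intervalIntegral.integral_const_mul, intervalIntegral.integral_const_mul,
    intervalIntegral.integral_const,
    intervalIntegral_intervalIntegral_swap] at hI
  · have hx : ∀ x, ∫ t in (0:ℝ)..τ, (a + b * x) * v x t * vt x t =
        (a + b * x) * v x τ ^ 2 / 2 - (a + b * x) * v x 0 ^ 2 / 2 := by
      intro x
      have k0 := st v cc0 x
      have kt := st vt cct x
      apply intervalIntegral.integral_eq_sub_of_hasDerivAt
        (f := fun t => (a + b * x) * v x t ^ 2 / 2)
      · intro t _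
        refine ((((ht x t).pow 2).const_mul (a + b * x)).div_const 2).congr_deriv ?_
        simp
        ring
      · exact Continuous.intervalIntegrable (by fun_prop) _ _
    have k0 := sx v cc0 τ
    have k1 := sx v cc0 0
    simp only [hx] at hI
    rw [intervalIntegral.integral_sub, intervalIntegral.integral_div,
      intervalIntegral.integral_div] at hI
    · rw [intervalIntegral.integral_const_mul] at hI
      simp only [smul_eq_mul, sub_zero] at hI
      linarith
    all_goals exact Continuous.intervalIntegrable (by fun_prop) _ _
  · refine IntegrableOn.mono_set (t := uIcc 0 τ ×ˢ uIcc 0 L) ?_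
      (prod_mono uIoc_subset_uIcc uIoc_subset_uIcc)
    apply ContinuousOn.integrableOn_compact (isCompact_uIcc.prod isCompact_uIcc)
    apply Continuous.continuousOn
    have : Continuous fun p : ℝ × ℝ => (a + b * p.1) * v p.1 p.2 * vt p.1 p.2 := by fun_prop
    exact this.comp continuous_swap
  all_goals exact Continuous.intervalIntegrable (by fun_prop) _ _

theorem apriori_estimate_linear_forced
    (L T : ℝ) (hL : 0 < L) (hT : 0 < T) :
    ∃ C > (0:ℝ), ∀ v : ℝ → ℝ → ℝ,
      ContDiff ℝ (⊤ : ℕ∞) (Function.uncurry v) →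
      (∀ t ∈ Icc (0:ℝ) T,
        v 0 t = 0 ∧ deriv (fun y => v y t) L = 0
          ∧ iteratedDeriv 2 (fun y => v y t) L = 0) →
      ∀ f : ℝ → ℝ → ℝ,
      (∀ x t, f x t = deriv (fun s => v x s) t + deriv (fun y => v y t) x
          + iteratedDeriv 3 (fun y => v y t) x) →
      (⨆ t : Icc (0:ℝ) T, Real.sqrt (∫ x in (0:ℝ)..L, (v x ↑t)^2))
        + Real.sqrt (∫ t in (0:ℝ)..T, ∫ x in (0:ℝ)..L, (deriv (fun y => v y t) x)^2)
      ≤ C * (Real.sqrt (∫ x in (0:ℝ)..L, (v x 0)^2)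
          + ∫ t in (0:ℝ)..T, Real.sqrt (∫ x in (0:ℝ)..L, (f x t)^2)) := by
  refine ⟨2 + Real.sqrt (3 * L + 2 * T), by positivity, ?_⟩
  intro v hv hbc f hf
  obtain ⟨s1, d0, s_t, dt⟩ := partial_aux v hv
  obtain ⟨s2, d1, -, -⟩ := partial_aux _ s1
  obtain ⟨s3, d2, -, -⟩ := partial_aux _ s2
  set v1 : ℝ → ℝ → ℝ := fun x t => deriv (fun y => v y t) x with hv1
  set v2 : ℝ → ℝ → ℝ := fun x t => deriv (fun y => v1 y t) x with hv2
  set v3 : ℝ → ℝ → ℝ := fun x t => deriv (fun y => v2 y t) x with hv3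
  have i2 : ∀ x t, iteratedDeriv 2 (fun y => v y t) x = v2 x t := by
    intro x t; simp only [iteratedDeriv_succ, iteratedDeriv_zero]; rfl
  have i3 : ∀ x t, iteratedDeriv 3 (fun y => v y t) x = v3 x t := by
    intro x t; simp only [iteratedDeriv_succ, iteratedDeriv_zero]; rfl
  have hbc' : ∀ t ∈ Icc (0:ℝ) T, v 0 t = 0 ∧ v1 L t = 0 ∧ v2 L t = 0 := by
    intro t ht; rw [← i2]; exact hbc t ht
  have hf' : ∀ x t, f x t = deriv (fun s => v x s) t + v1 x t + v3 x t := by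
    intro x t; rw [← i3]; exact hf x t
  have cv := hv.continuous
  have cf : Continuous (Function.uncurry f) := by
    have c1 := s1.continuous
    have c3 := s3.continuous
    have ct := s_t.continuous
    have : Function.uncurry f = fun p =>
      Function.uncurry (fun x t => deriv (fun s => v x s) t) p + Function.uncurry v1 p
      + Function.uncurry v3 p := by ext ⟨x, t⟩; exact hf' x t
    rw [this]; exact (ct.add c1).add c3
  have key : ∀ a b M : ℝ, 0 ≤ a → 0 ≤ b → _ := fun a b M ha hb =>
    energy_aux L T a b M hL ha hb v v1 v2 v3
      (fun x t => deriv (fun s => v x s) t) cv s1.continuous s3.continuous s_t.continuous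
      d0 d1 d2 dt hbc' f hf'
  have ip : ∀ w : ℝ → ℝ → ℝ, Continuous (Function.uncurry w) →
      Continuous fun t => Real.sqrt (∫ x in (0:ℝ)..L, w x t ^ 2) := fun w hw =>
    (intervalIntegral.continuous_parametric_intervalIntegral_of_continuous'
      (f := fun t x => w x t ^ 2) (show Continuous fun p : ℝ × ℝ => w p.2 p.1 ^ 2 from
        (hw.comp continuous_swap).pow 2) 0 L).sqrt
  have cn := ip v cv
  have cg := ip f cf
  have mono : ∀ τ ∈ Icc (0:ℝ) T, ∫ t in (0:ℝ)..τ, Real.sqrt (∫ x in (0:ℝ)..L, f x t ^ 2) ≤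
      ∫ t in (0:ℝ)..T, Real.sqrt (∫ x in (0:ℝ)..L, f x t ^ 2) := by
    intro τ hτ
    apply intervalIntegral.integral_mono_interval le_rfl hτ.1 hτ.2
    · exact Filter.Eventually.of_forall fun t => Real.sqrt_nonneg _
    · exact cg.intervalIntegrable _ _
  have hG0 : 0 ≤ ∫ t in (0:ℝ)..T, Real.sqrt (∫ x in (0:ℝ)..L, f x t ^ 2) :=
    intervalIntegral.integral_nonneg hT.le (fun t _ => Real.sqrt_nonneg _)
  set G := ∫ t in (0:ℝ)..T, Real.sqrt (∫ x in (0:ℝ)..L, f x t ^ 2) with hG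
  obtain ⟨τ, hτ, hmax⟩ := isCompact_Icc.exists_isMaxOn (nonempty_Icc.2 hT.le) cn.continuousOn
  have hM : ∀ t ∈ Icc (0:ℝ) T, Real.sqrt (∫ x in (0:ℝ)..L, v x t ^ 2) ≤
    Real.sqrt (∫ x in (0:ℝ)..L, v x τ ^ 2) := fun t ht => hmax ht
  have hsq : ∀ t, Real.sqrt (∫ x in (0:ℝ)..L, v x t ^ 2) ^ 2 = ∫ x in (0:ℝ)..L, v x t ^ 2 :=
    fun t => Real.sq_sqrt (intervalIntegral.integral_nonneg hL.le (fun x _ => sq_nonneg _))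
  have hn0 := Real.sqrt_nonneg (∫ x in (0:ℝ)..L, v x 0 ^ 2)
  have hm0 := Real.sqrt_nonneg (∫ x in (0:ℝ)..L, v x τ ^ 2)
  have E1 := key 1 0 _ zero_le_one le_rfl hM τ hτ
  have E2 := key 0 1 _ le_rfl zero_le_one hM T ⟨hT.le, le_rfl⟩
  simp only [zero_mul, add_zero, one_mul, zero_add, mul_zero, zero_div] at E1 E2
  rw [← hsq τ, ← hsq 0, Real.sqrt_sq hm0] at E1
  rw [← hG] at E2
  have hw0 : ∫ x in (0:ℝ)..L, x * v x 0 ^ 2 ≤ L * ∫ x in (0:ℝ)..L, v x 0 ^ 2 := by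
    have k : Continuous fun x => v x 0 := cv.comp (continuous_id.prodMk continuous_const)
    rw [← intervalIntegral.integral_const_mul]
    apply intervalIntegral.integral_mono_on hL.le
    · exact Continuous.intervalIntegrable (by fun_prop) _ _
    · exact Continuous.intervalIntegrable (by fun_prop) _ _
    · intro x hx
      exact mul_le_mul_of_nonneg_right hx.2 (sq_nonneg _)
  have hwT : 0 ≤ ∫ x in (0:ℝ)..L, x * v x T ^ 2 :=
    intervalIntegral.integral_nonneg hL.le (fun x hx => mul_nonneg hx.1 (sq_nonneg _))
  rw [← hsq 0] at hw0
  have hmono := mono τ hτ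
  have hsup : (⨆ t : Icc (0:ℝ) T, Real.sqrt (∫ x in (0:ℝ)..L, (v x ↑t)^2)) ≤
      Real.sqrt (∫ x in (0:ℝ)..L, v x τ ^ 2) := by
    have : Nonempty (Icc (0:ℝ) T) := ⟨⟨τ, hτ⟩⟩
    exact ciSup_le fun t => hM t t.2
  generalize Real.sqrt (∫ x in (0:ℝ)..L, v x τ ^ 2) = M at *
  generalize Real.sqrt (∫ x in (0:ℝ)..L, v x 0 ^ 2) = N at *
  have hMG := mul_le_mul_of_nonneg_left hmono hm0
  have hMN : M ≤ 2 * (N + G) := by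
    by_contra hcon
    push Not at hcon
    nlinarith [mul_nonneg hn0 hG0]
  have hD : ∫ t in (0:ℝ)..T, ∫ x in (0:ℝ)..L, v1 x t ^ 2 ≤ (3 * L + 2 * T) * (N + G) ^ 2 := by
    have a1 : M * G ≤ 2 * (N + G) ^ 2 := by nlinarith [mul_nonneg hn0 hG0, mul_nonneg hm0 hG0]
    have a2 : M ^ 2 ≤ 4 * (N + G) ^ 2 := by nlinarith
    have a3 : N ^ 2 ≤ (N + G) ^ 2 := by nlinarith [mul_nonneg hn0 hG0]
    have b1 := mul_le_mul_of_nonneg_left a1 hL.le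
    have b2 := mul_le_mul_of_nonneg_left a2 hT.le
    have b3 := mul_le_mul_of_nonneg_left a3 hL.le
    have b4 := mul_nonneg hL.le (sq_nonneg (N + G))
    have b5 := mul_nonneg hT.le (sq_nonneg (N + G))
    nlinarith
  have hD2 : Real.sqrt (∫ t in (0:ℝ)..T, ∫ x in (0:ℝ)..L, v1 x t ^ 2) ≤
      Real.sqrt (3 * L + 2 * T) * (N + G) := by
    calc _ ≤ Real.sqrt ((3 * L + 2 * T) * (N + G) ^ 2) := Real.sqrt_le_sqrt hD
      _ = _ := by rw [Real.sqrt_mul (by positivity), Real.sqrt_sq (by positivity)]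
  have : (2 + Real.sqrt (3 * L + 2 * T)) * (N + G)
    = 2 * (N + G) + Real.sqrt (3 * L + 2 * T) * (N + G) := by ring
  rw [this]
  exact add_le_add (hsup.trans hMN) hD2
end

section
/- Let L > 0, T > 0 and let v : ℝ × ℝ → ℝ be a smooth function satisfying v_t + v_x + v_xxx = 0 on [0,L] × [0,T] together with the boundary conditions v(0,t) = 0, v_x(L,t) = 0, v_xx(L,t) = 0 for all t ∈ [0,T]. Then (i) for every t ∈ [0,T], ∫₀^L v(x,t)² dx ≤ ∫₀^L v(x,0)² dx, and (ii) 3 ∫₀^T ∫₀^L v_x(x,t)² dx dt ≤ (L + T) ∫₀^L v(x,0)² dx. -/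
open MeasureTheory Set

lemma aux_dx (f : ℝ → ℝ → ℝ) (hf : ContDiff ℝ (⊤ : ℕ∞) (Function.uncurry f)) :
    ContDiff ℝ (⊤ : ℕ∞) (Function.uncurry (fun x t => deriv (fun y => f y t) x)) ∧
    ∀ x t, HasDerivAt (fun y => f y t) (deriv (fun y => f y t) x) x := by
  have hd : Differentiable ℝ (Function.uncurry f) := hf.differentiable (by simp)
  have key : ∀ x t, HasDerivAt (fun y => f y t)
      (fderiv ℝ (Function.uncurry f) (x, t) (1, 0)) x := by
    intro x t
    have h1 : HasDerivAt (fun y : ℝ => (y, t)) ((1 : ℝ), (0 : ℝ)) x :=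
      (hasDerivAt_id x).prodMk (hasDerivAt_const x t)
    exact HasFDerivAt.comp_hasDerivAt x (hd (x, t)).hasFDerivAt h1
  refine ⟨?_, fun x t => (key x t).differentiableAt.hasDerivAt⟩
  have : Function.uncurry (fun x t => deriv (fun y => f y t) x) =
      fun p => fderiv ℝ (Function.uncurry f) p (1, 0) := by
    ext ⟨x, t⟩
    exact (key x t).deriv
  rw [this]
  exact (hf.fderiv_right (m := (⊤ : ℕ∞)) (by simp)).clm_apply contDiff_const

lemma aux_dt (f : ℝ → ℝ → ℝ) (hf : ContDiff ℝ (⊤ : ℕ∞) (Function.uncurry f)) :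
    ContDiff ℝ (⊤ : ℕ∞) (Function.uncurry (fun x t => deriv (fun s => f x s) t)) ∧
    ∀ x t, HasDerivAt (fun s => f x s) (deriv (fun s => f x s) t) t := by
  have h : ContDiff ℝ (⊤ : ℕ∞) (Function.uncurry (fun t x => f x t)) :=
    hf.comp (contDiff_snd.prodMk contDiff_fst)
  obtain ⟨h1, h2⟩ := aux_dx _ h
  exact ⟨h1.comp (contDiff_snd.prodMk contDiff_fst), fun x t => h2 t x⟩

/-- time-integrated identity -/
lemma aux_energy (L t : ℝ) (w : ℝ → ℝ) (hw : Continuous w) (v vt : ℝ → ℝ → ℝ)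
    (hv : Continuous (Function.uncurry v)) (hvt : Continuous (Function.uncurry vt))
    (hd : ∀ x t, HasDerivAt (fun s => v x s) (vt x t) t) :
    (∫ x in (0:ℝ)..L, w x * (v x t)^2) - (∫ x in (0:ℝ)..L, w x * (v x 0)^2)
      = ∫ s in (0:ℝ)..t, ∫ x in (0:ℝ)..L, w x * (2 * v x s * vt x s) := by
  have hc : Continuous (Function.uncurry fun x s => w x * (2 * v x s * vt x s)) := by
    change Continuous fun p : ℝ × ℝ => w p.1 * (2 * Function.uncurry v p * Function.uncurry vt p)
    fun_prop
  have hvx : ∀ s, Continuous fun x => v x s := fun s =>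
    hv.comp (f := fun x => (x, s)) (by fun_prop)
  rw [← intervalIntegral.integral_sub
    (Continuous.intervalIntegrable (by have := hvx t; fun_prop) _ _)
    (Continuous.intervalIntegrable (by have := hvx 0; fun_prop) _ _)]
  have hi : IntegrableOn (Function.uncurry fun x s => w x * (2 * v x s * vt x s))
      (uIoc 0 L ×ˢ uIoc 0 t) := by
    exact (hc.continuousOn.integrableOn_compact
      (isCompact_uIcc.prod isCompact_uIcc)).mono_set
      (prod_mono uIoc_subset_uIcc uIoc_subset_uIcc)
  rw [← intervalIntegral_intervalIntegral_swap hi]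
  refine intervalIntegral.integral_congr fun x _ => ?_
  symm
  apply intervalIntegral.integral_eq_sub_of_hasDerivAt (f := fun s => w x * (v x s)^2)
  · intro s _
    have q0 := ((hd x s).fun_pow 2).const_mul (w x)
    simp only [Nat.cast_ofNat, Nat.add_one_sub_one, pow_one] at q0
    exact q0
  · exact (hc.comp (f := fun s => (x, s)) (by fun_prop)).intervalIntegrable _ _

theorem kato_smoothing_homogeneous_linear
    (L T : ℝ) (hL : 0 < L) (hT : 0 < T)
    (v : ℝ → ℝ → ℝ)
    (hv : ContDiff ℝ (⊤ : ℕ∞) (Function.uncurry v))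
    (heq : ∀ x ∈ Icc (0:ℝ) L, ∀ t ∈ Icc (0:ℝ) T,
      deriv (fun s => v x s) t + deriv (fun y => v y t) x
        + iteratedDeriv 3 (fun y => v y t) x = 0)
    (hbc : ∀ t ∈ Icc (0:ℝ) T,
      v 0 t = 0 ∧ deriv (fun y => v y t) L = 0
        ∧ iteratedDeriv 2 (fun y => v y t) L = 0) :
    (∀ t ∈ Icc (0:ℝ) T,
      (∫ x in (0:ℝ)..L, (v x t)^2) ≤ ∫ x in (0:ℝ)..L, (v x 0)^2)
    ∧ 3 * (∫ t in (0:ℝ)..T, ∫ x in (0:ℝ)..L, (deriv (fun y => v y t) x)^2)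
        ≤ (L + T) * ∫ x in (0:ℝ)..L, (v x 0)^2 := by
  obtain ⟨c1, d1⟩ := aux_dx v hv
  obtain ⟨c2, d2⟩ := aux_dx _ c1
  obtain ⟨c3, d3⟩ := aux_dx _ c2
  obtain ⟨ct, dt⟩ := aux_dt v hv
  simp only [iteratedDeriv_succ, iteratedDeriv_zero] at heq hbc
  generalize hv1 : (fun x t => deriv (fun y => v y t) x) = v1 at *
  have e1 : ∀ x t, deriv (fun y => v y t) x = v1 x t := fun x t => by rw [← hv1]
  have e1' : ∀ t, deriv (fun y => v y t) = fun x => v1 x t := fun t => by rw [← hv1]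
  simp only [e1'] at *
  generalize hv2 : (fun x t => deriv (fun y => v1 y t) x) = v2 at *
  have e2' : ∀ t, deriv (fun y => v1 y t) = fun x => v2 x t := fun t => by rw [← hv2]
  simp only [e2'] at *
  generalize hv3 : (fun x t => deriv (fun y => v2 y t) x) = v3 at *
  have e3' : ∀ t, deriv (fun y => v2 y t) = fun x => v3 x t := fun t => by rw [← hv3]
  simp only [e3'] at *
  generalize hvt : (fun x t => deriv (fun y => v x y) t) = vt at *
  have et' : ∀ x, deriv (fun y => v x y) = fun t => vt x t := fun t => by rw [← hvt]
  simp only [et'] at *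
  clear et' hvt e3' hv3 e2' hv2 e1' hv1 e1
  have k0 := hv.continuous
  replace c1 := c1.continuous
  replace c2 := c2.continuous
  replace c3 := c3.continuous
  replace ct := ct.continuous
  have sl : ∀ {f : ℝ → ℝ → ℝ}, Continuous (Function.uncurry f) → ∀ s, Continuous fun x => f x s :=
    fun hf s => hf.comp (f := fun x => (x, s)) (by fun_prop)
  have sr : ∀ {f : ℝ → ℝ → ℝ}, Continuous (Function.uncurry f) → ∀ x, Continuous fun s => f x s :=
    fun hf x => hf.comp (f := fun s => (x, s)) (by fun_prop)
  have par : ∀ {f : ℝ → ℝ → ℝ}, Continuous (Function.uncurry f) →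
      Continuous fun s => ∫ x in (0:ℝ)..L, (f x s)^2 := by
    intro f hf
    apply intervalIntegral.continuous_parametric_intervalIntegral_of_continuous'
    change Continuous fun p : ℝ × ℝ => (Function.uncurry f (p.2, p.1))^2
    fun_prop
  have A1 : ∀ s ∈ Icc (0:ℝ) T, (∫ x in (0:ℝ)..L, 1 * (2 * v x s * vt x s)) ≤ 0 := by
    intro s hs
    have i0 := sl k0 s
    have it := sl ct s
    have h := intervalIntegral.integral_eq_sub_of_hasDerivAt (a := 0) (b := L)
      (f := fun x => -(v x s)^2 - 2 * (v x s * v2 x s) + (v1 x s)^2)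
      (f' := fun x => 1 * (2 * v x s * vt x s)) ?_ (Continuous.intervalIntegrable (by fun_prop) _ _)
    · rw [h]
      obtain ⟨b0, b1, b2⟩ := hbc s hs
      simp only [b0, b1, b2]
      nlinarith [sq_nonneg (v L s), sq_nonneg (v1 0 s)]
    · intro x hx
      rw [uIcc_of_le hL.le] at hx
      have := heq x hx s hs
      have e : vt x s = - v1 x s - v3 x s := by linarith
      refine HasDerivAt.congr_deriv (f' := -(2 * v x s * v1 x s)
        - 2 * (v1 x s * v2 x s + v x s * v3 x s) + 2 * v1 x s * v2 x s) ?_ (by rw [e]; ring)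
      have q0 := (d1 x s).fun_pow 2
      have q1 := (d2 x s).fun_pow 2
      simp only [Nat.cast_ofNat, Nat.add_one_sub_one, pow_one] at q0 q1
      exact (q0.fun_neg.fun_sub (((d1 x s).fun_mul (d3 x s)).const_mul 2)).fun_add q1
  have A2 : ∀ s ∈ Icc (0:ℝ) T, (∫ x in (0:ℝ)..L, x * (2 * v x s * vt x s)) ≤
      (∫ x in (0:ℝ)..L, (v x s)^2) - 3 * ∫ x in (0:ℝ)..L, (v1 x s)^2 := by
    intro s hs
    have i0 := sl k0 s
    have i1 := sl c1 s
    have it := sl ct s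
    have h := intervalIntegral.integral_eq_sub_of_hasDerivAt (a := 0) (b := L)
      (f := fun x => x * (-(v x s)^2 - 2 * (v x s * v2 x s) + (v1 x s)^2) + 2 * (v x s * v1 x s))
      (f' := fun x => x * (2 * v x s * vt x s) - ((v x s)^2 - 3 * (v1 x s)^2)) ?_
      (Continuous.intervalIntegrable (by fun_prop) _ _)
    · rw [intervalIntegral.integral_sub (Continuous.intervalIntegrable (by fun_prop) _ _)
        (Continuous.intervalIntegrable (by fun_prop) _ _),
        intervalIntegral.integral_sub (Continuous.intervalIntegrable (by fun_prop) _ _)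
        (Continuous.intervalIntegrable (by fun_prop) _ _),
        intervalIntegral.integral_const_mul] at h
      obtain ⟨b0, b1, b2⟩ := hbc s hs
      simp only [b0, b1, b2] at h
      nlinarith [mul_nonneg hL.le (sq_nonneg (v L s))]
    · intro x hx
      rw [uIcc_of_le hL.le] at hx
      have := heq x hx s hs
      have e : vt x s = - v1 x s - v3 x s := by linarith
      refine HasDerivAt.congr_deriv (f' := (1 * (-(v x s)^2 - 2 * (v x s * v2 x s) + (v1 x s)^2)
        + x * (-(2 * v x s * v1 x s)
        - 2 * (v1 x s * v2 x s + v x s * v3 x s) + 2 * v1 x s * v2 x s))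
        + 2 * (v1 x s * v1 x s + v x s * v2 x s)) ?_ (by rw [e]; ring)
      have q0 := (d1 x s).fun_pow 2
      have q1 := (d2 x s).fun_pow 2
      simp only [Nat.cast_ofNat, Nat.add_one_sub_one, pow_one] at q0 q1
      exact ((hasDerivAt_id' x).fun_mul ((q0.fun_neg.fun_sub
        (((d1 x s).fun_mul (d3 x s)).const_mul 2)).fun_add q1)).fun_add
        (((d1 x s).fun_mul (d2 x s)).const_mul 2)
  have B1 : ∀ t ∈ Icc (0:ℝ) T,
      (∫ x in (0:ℝ)..L, (v x t)^2) ≤ ∫ x in (0:ℝ)..L, (v x 0)^2 := by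
    intro t ht
    have h := aux_energy L t (fun _ => 1) continuous_const v vt k0 ct dt
    have h2 : 0 ≤ ∫ s in (0:ℝ)..t, -∫ x in (0:ℝ)..L, 1 * (2 * v x s * vt x s) :=
      intervalIntegral.integral_nonneg ht.1 fun s hs => by
        linarith [A1 s ⟨hs.1, hs.2.trans ht.2⟩]
    rw [intervalIntegral.integral_neg] at h2
    simp only [one_mul] at h h2
    linarith
  refine ⟨B1, ?_⟩
  have h := aux_energy L T (fun x => x) continuous_id v vt k0 ct dt
  have p0 := par k0
  have p1 := par c1
  have h1 : (∫ s in (0:ℝ)..T, ∫ x in (0:ℝ)..L, x * (2 * v x s * vt x s)) ≤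
      ∫ s in (0:ℝ)..T, ((∫ x in (0:ℝ)..L, (v x 0)^2) - 3 * ∫ x in (0:ℝ)..L, (v1 x s)^2) := by
    apply intervalIntegral.integral_mono_on hT.le
    · apply Continuous.intervalIntegrable
      apply intervalIntegral.continuous_parametric_intervalIntegral_of_continuous'
      change Continuous fun p : ℝ × ℝ => p.2 * (2 * Function.uncurry v (p.2, p.1) * Function.uncurry vt (p.2, p.1))
      fun_prop
    · exact Continuous.intervalIntegrable (by fun_prop) _ _
    · intro s hs
      linarith [A2 s hs, B1 s hs]
  rw [intervalIntegral.integral_sub (Continuous.intervalIntegrable (by fun_prop) _ _)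
        (Continuous.intervalIntegrable (by fun_prop) _ _), intervalIntegral.integral_const_mul,
        intervalIntegral.integral_const] at h1
  have i0 := sl k0 0
  have h2 : 0 ≤ ∫ x in (0:ℝ)..L, x * (v x T)^2 :=
    intervalIntegral.integral_nonneg hL.le fun x hx => mul_nonneg hx.1 (sq_nonneg _)
  have h3 : (∫ x in (0:ℝ)..L, x * (v x 0)^2) ≤ ∫ x in (0:ℝ)..L, L * (v x 0)^2 := by
    apply intervalIntegral.integral_mono_on hL.le
      (Continuous.intervalIntegrable (by fun_prop) _ _)
      (Continuous.intervalIntegrable (by fun_prop) _ _)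
    intro x hx
    exact mul_le_mul_of_nonneg_right hx.2 (sq_nonneg _)
  rw [intervalIntegral.integral_const_mul] at h3
  simp only [sub_zero, smul_eq_mul] at h1
  linarith
end

section
/- Let L > 0, T > 0 and let u : ℝ × ℝ → ℝ be a smooth function satisfying u_t + u_x + u_xxx + u u_x = 0 on [0,L] × [0,T] together with the homogeneous boundary conditions u(0,t) = 0, u_x(L,t) = 0, u_xx(L,t) = 0 for all t ∈ [0,T]. Then for every t ∈ [0,T], (d/dt) ∫₀^L u(x,t)² dx = − u(L,t)² − u_x(0,t)² − (2/3) u(L,t)³. -/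
open MeasureTheory Set

theorem energy_derivative_kdv_colin_ghidaglia
    (L T : ℝ) (hL : 0 < L) (hT : 0 < T)
    (u : ℝ → ℝ → ℝ)
    (hu : ContDiff ℝ (⊤ : ℕ∞) (Function.uncurry u))
    (heq : ∀ x ∈ Icc (0:ℝ) L, ∀ t ∈ Icc (0:ℝ) T,
      deriv (fun s => u x s) t + deriv (fun y => u y t) x
        + iteratedDeriv 3 (fun y => u y t) x
        + u x t * deriv (fun y => u y t) x = 0)
    (hbc : ∀ t ∈ Icc (0:ℝ) T,
      u 0 t = 0 ∧ deriv (fun y => u y t) L = 0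
        ∧ iteratedDeriv 2 (fun y => u y t) L = 0) :
    ∀ t ∈ Icc (0:ℝ) T,
      deriv (fun s => ∫ x in (0:ℝ)..L, (u x s)^2) t
      = -(u L t)^2 - (deriv (fun y => u y t) 0)^2 - (2/3) * (u L t)^3 := by
  intro t ht
  obtain ⟨h0, h1, h2⟩ := hbc t ht
  have hcu : Continuous (Function.uncurry u) := hu.continuous
  have hut : ∀ x s, HasDerivAt (fun s => u x s)
      (fderiv ℝ (Function.uncurry u) (x, s) (0, 1)) s := by
    intro x s
    have hd : HasFDerivAt (Function.uncurry u) (fderiv ℝ (Function.uncurry u) (x, s)) (x, s) :=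
      (hu.differentiable (by simp) _).hasFDerivAt
    exact hd.comp_hasDerivAt s ((hasDerivAt_const s x).prodMk (hasDerivAt_id s))
  have hcf : Continuous (fun p : ℝ × ℝ => fderiv ℝ (Function.uncurry u) p (0, 1)) :=
    (hu.continuous_fderiv (by simp)).clm_apply continuous_const
  set G : ℝ → ℝ → ℝ := fun s x => 2 * u x s * fderiv ℝ (Function.uncurry u) (x, s) (0, 1) with hG
  have hcG : Continuous (fun p : ℝ × ℝ => G p.2 p.1) := by
    have : Continuous (fun p : ℝ × ℝ => u p.1 p.2) := hcu
    exact (continuous_const.mul this).mul hcf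
  have hcx : ∀ s, Continuous (fun x => u x s) := fun s =>
    hcu.comp (continuous_id.prodMk continuous_const)
  have hcGx : ∀ s, Continuous (G s) := fun s =>
    hcG.comp (continuous_id.prodMk continuous_const)
  obtain ⟨C, hC⟩ := ((isCompact_Icc (a := (0:ℝ)) (b := L)).prod
    (isCompact_Icc (a := t - 1) (b := t + 1))).exists_bound_of_continuousOn hcG.continuousOn
  have key := (intervalIntegral.hasDerivAt_integral_of_dominated_loc_of_deriv_le
    (μ := volume) (a := 0) (b := L) (F := fun s x => (u x s)^2) (F' := G) (x₀ := t)
    (s := Icc (t - 1) (t + 1)) (bound := fun _ => C)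
    (Icc_mem_nhds (by linarith) (by linarith))
    (Filter.Eventually.of_forall fun s => ((hcx s).pow 2).aestronglyMeasurable)
    (((hcx t).pow 2).intervalIntegrable _ _)
    (hcGx t).aestronglyMeasurable
    (Filter.Eventually.of_forall fun x hx s hs => by
      rw [uIoc_of_le hL.le] at hx
      exact hC (x, s) ⟨⟨hx.1.le, hx.2⟩, hs⟩)
    intervalIntegrable_const
    (Filter.Eventually.of_forall fun x _ s _ => by
      have := (hut x s).fun_pow 2
      simpa [hG] using this)).2
  rw [key.deriv]
  set v : ℝ → ℝ := fun y => u y t with hv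
  have hvs : ContDiff ℝ (⊤ : ℕ∞) v := hu.comp (contDiff_id.prodMk contDiff_const)
  have hd : ∀ n x, HasDerivAt (iteratedDeriv n v) (iteratedDeriv (n+1) v x) x := by
    intro n x
    rw [iteratedDeriv_succ]
    exact (hvs.differentiable_iteratedDeriv n (by exact_mod_cast WithTop.coe_lt_top _) x).hasDerivAt
  have d0 := hd 0
  have d1 := hd 1
  have d2 := hd 2
  simp only [iteratedDeriv_zero, zero_add, iteratedDeriv_one] at d0 d1
  norm_num at d1 d2
  have hI := intervalIntegral.integral_eq_sub_of_hasDerivAt (a := 0) (b := L)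
    (f := fun x => -(v x ^ 2 + 2 * (v x * iteratedDeriv 2 v x) - deriv v x ^ 2
      + (2/3) * v x ^ 3)) (f' := G t) (fun x hx => by
      rw [uIcc_of_le hL.le] at hx
      have e := heq x hx t ht
      rw [(hut x t).deriv] at e
      have := (((((d0 x).fun_pow 2).fun_add (((d0 x).fun_mul (d2 x)).const_mul 2)).fun_sub
        ((d1 x).fun_pow 2)).fun_add (((d0 x).fun_pow 3).const_mul (2/3))).fun_neg
      refine this.congr_deriv ?_
      simp only [hG]
      have hx' : u x t = v x := rfl
      rw [hx'] at e ⊢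
      norm_num
      linear_combination (-2 * v x) * e) ((hcGx t).intervalIntegrable _ _)
  rw [hI]
  have a0 : v 0 = 0 := h0
  have aL : u L t = v L := rfl
  simp only [h1, h2, a0, aL]
  ring
end

section
/- Let L > 0, T > 0 and let u, v : ℝ × ℝ → ℝ be smooth functions that both satisfy the KdV equation w_t + w_x + w_xxx + w w_x = 0 on [0,L] × [0,T]. Assume u(x,0) = v(x,0) for all x ∈ [0,L], and u(0,t) = v(0,t), u_x(L,t) = v_x(L,t), u_xx(L,t) = v_xx(L,t) for all t ∈ [0,T]. Then u(x,t) = v(x,t) for all (x,t) ∈ [0,L] × [0,T]. -/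
open Set

lemma kdv_partial_x (f : ℝ → ℝ → ℝ) (hf : ContDiff ℝ (⊤ : ℕ∞) (Function.uncurry f)) :
    ∃ p : ℝ → ℝ → ℝ, ContDiff ℝ (⊤ : ℕ∞) (Function.uncurry p) ∧
      ∀ x t, HasDerivAt (fun y => f y t) (p x t) x := by
  refine ⟨fun x t => fderiv ℝ (Function.uncurry f) (x, t) (1, 0), ?_, ?_⟩
  · have h : ContDiff ℝ (⊤ : ℕ∞) (fderiv ℝ (Function.uncurry f)) :=
      hf.fderiv_right (by simp)
    exact h.clm_apply contDiff_const
  · intro x t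
    have h1 : HasFDerivAt (Function.uncurry f) (fderiv ℝ (Function.uncurry f) (x, t)) (x, t) :=
      ((hf.differentiable (by simp)) (x, t)).hasFDerivAt
    have h2 : HasDerivAt (fun y : ℝ => (y, t)) ((1 : ℝ), (0 : ℝ)) x :=
      (hasDerivAt_id x).prodMk (hasDerivAt_const x t)
    exact h1.comp_hasDerivAt x h2

lemma kdv_partial_t (f : ℝ → ℝ → ℝ) (hf : ContDiff ℝ (⊤ : ℕ∞) (Function.uncurry f)) :
    ∃ p : ℝ → ℝ → ℝ, ContDiff ℝ (⊤ : ℕ∞) (Function.uncurry p) ∧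
      ∀ x t, HasDerivAt (fun s => f x s) (p x t) t := by
  refine ⟨fun x t => fderiv ℝ (Function.uncurry f) (x, t) (0, 1), ?_, ?_⟩
  · have h : ContDiff ℝ (⊤ : ℕ∞) (fderiv ℝ (Function.uncurry f)) :=
      hf.fderiv_right (by simp)
    exact h.clm_apply contDiff_const
  · intro x t
    have h1 : HasFDerivAt (Function.uncurry f) (fderiv ℝ (Function.uncurry f) (x, t)) (x, t) :=
      ((hf.differentiable (by simp)) (x, t)).hasFDerivAt
    have h2 : HasDerivAt (fun y : ℝ => (x, y)) ((0 : ℝ), (1 : ℝ)) t :=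
      (hasDerivAt_const t x).prodMk (hasDerivAt_id t)
    exact h1.comp_hasDerivAt t h2

lemma kdv_bdd (L T : ℝ) (g : ℝ → ℝ → ℝ) (hg : Continuous fun p : ℝ × ℝ => g p.1 p.2) :
    ∃ C : ℝ, 0 ≤ C ∧ ∀ x ∈ Icc (0:ℝ) L, ∀ t ∈ Icc (0:ℝ) T, |g x t| ≤ C := by
  obtain ⟨C, hC⟩ := ((isCompact_Icc (a := (0:ℝ)) (b := L)).prod
    (isCompact_Icc (a := (0:ℝ)) (b := T))).exists_bound_of_continuousOn hg.continuousOn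
  exact ⟨max C 0, le_max_right _ _, fun x hx t ht => (hC (x, t) ⟨hx, ht⟩).trans (le_max_left _ _)⟩

lemma kdv_deriv_int (L : ℝ) (g g' : ℝ → ℝ → ℝ)
    (hg : Continuous fun p : ℝ × ℝ => g p.1 p.2)
    (hg' : Continuous fun p : ℝ × ℝ => g' p.1 p.2)
    (hd : ∀ x t, HasDerivAt (fun s => g x s) (g' x t) t) (t : ℝ) :
    HasDerivAt (fun s => ∫ x in (0:ℝ)..L, g x s) (∫ x in (0:ℝ)..L, g' x t) t := by
  obtain ⟨C, hC⟩ := ((isCompact_uIcc (a := (0:ℝ)) (b := L)).prod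
    (isCompact_Icc (a := t - 1) (b := t + 1))).exists_bound_of_continuousOn hg'.continuousOn
  have c1 : ∀ s, Continuous fun x => g x s := fun s =>
    hg.comp (by fun_prop : Continuous fun x : ℝ => (x, s))
  have c2 : ∀ s, Continuous fun x => g' x s := fun s =>
    hg'.comp (by fun_prop : Continuous fun x : ℝ => (x, s))
  refine (intervalIntegral.hasDerivAt_integral_of_dominated_loc_of_deriv_le
    (F := fun s x => g x s) (F' := fun s x => g' x s) (bound := fun _ => C)
    (s := Icc (t - 1) (t + 1)) (Icc_mem_nhds (by linarith) (by linarith)) ?_ ?_ ?_ ?_ ?_ ?_).2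
  · exact Filter.Eventually.of_forall fun s => (c1 s).aestronglyMeasurable
  · exact (c1 t).intervalIntegrable _ _
  · exact (c2 t).aestronglyMeasurable
  · exact Filter.Eventually.of_forall fun x hx s hs => hC (x, s) ⟨uIoc_subset_uIcc hx, hs⟩
  · exact intervalIntegrable_const
  · exact Filter.Eventually.of_forall fun x hx s hs => hd x s

lemma kdv_core (L T : ℝ) (hL : 0 < L)
    (v ux vx w wx wxx wxxx wt : ℝ → ℝ → ℝ)
    (cv : Continuous fun p : ℝ × ℝ => v p.1 p.2)
    (cux : Continuous fun p : ℝ × ℝ => ux p.1 p.2)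
    (cvx : Continuous fun p : ℝ × ℝ => vx p.1 p.2)
    (cw : Continuous fun p : ℝ × ℝ => w p.1 p.2)
    (cwx : Continuous fun p : ℝ × ℝ => wx p.1 p.2)
    (cwxx : Continuous fun p : ℝ × ℝ => wxx p.1 p.2)
    (cwxxx : Continuous fun p : ℝ × ℝ => wxxx p.1 p.2)
    (cwt : Continuous fun p : ℝ × ℝ => wt p.1 p.2)
    (dv : ∀ x t, HasDerivAt (fun y => v y t) (vx x t) x)
    (dw : ∀ x t, HasDerivAt (fun y => w y t) (wx x t) x)
    (dwx : ∀ x t, HasDerivAt (fun y => wx y t) (wxx x t) x)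
    (dwxx : ∀ x t, HasDerivAt (fun y => wxx y t) (wxxx x t) x)
    (dwt : ∀ x t, HasDerivAt (fun s => w x s) (wt x t) t)
    (heq : ∀ x ∈ Icc (0:ℝ) L, ∀ t ∈ Icc (0:ℝ) T,
      wt x t + wx x t + wxxx x t + (w x t * ux x t + v x t * wx x t) = 0)
    (h0 : ∀ x ∈ Icc (0:ℝ) L, w x 0 = 0)
    (hb : ∀ t ∈ Icc (0:ℝ) T, w 0 t = 0 ∧ wx L t = 0 ∧ wxx L t = 0) :
    ∀ x ∈ Icc (0:ℝ) L, ∀ t ∈ Icc (0:ℝ) T, w x t = 0 := by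
  obtain ⟨M, hM0, hM⟩ := kdv_bdd L T v cv
  obtain ⟨a, ha1, haM⟩ : ∃ a : ℝ, 1 ≤ a ∧ M ≤ a := ⟨M + 1, by linarith, by linarith⟩
  obtain ⟨C, hC0, hC⟩ := kdv_bdd L T
    (fun x t => (a ^ 3 + a * (1 + v x t) + vx x t) / 2 - ux x t) (by fun_prop)
  have hsec : ∀ f : ℝ → ℝ → ℝ, (Continuous fun p : ℝ × ℝ => f p.1 p.2) →
      ∀ t, Continuous fun x => f x t := fun f hf t =>
    hf.comp (by fun_prop : Continuous fun x : ℝ => (x, t))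
  have sv := hsec v cv
  have svx := hsec vx cvx
  have sw := hsec w cw
  have swx := hsec wx cwx
  have swxx := hsec wxx cwxx
  have swxxx := hsec wxxx cwxxx
  have swt := hsec wt cwt
  set E : ℝ → ℝ := fun t => ∫ x in (0:ℝ)..L, Real.exp (a * x) * w x t ^ 2 with hE
  have dE : ∀ t, HasDerivAt E (∫ x in (0:ℝ)..L, Real.exp (a * x) * (2 * w x t * wt x t)) t := by
    intro t
    refine kdv_deriv_int L (fun x t => Real.exp (a * x) * w x t ^ 2)
      (fun x t => Real.exp (a * x) * (2 * w x t * wt x t)) (by fun_prop) (by fun_prop) ?_ t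
    intro x t
    have := ((dwt x t).pow 2).const_mul (Real.exp (a * x))
    refine this.congr_deriv ?_
    simp
  have key : ∀ t ∈ Icc (0:ℝ) T,
      (∫ x in (0:ℝ)..L, Real.exp (a * x) * (2 * w x t * wt x t)) ≤ 2 * C * E t := by
    intro t ht
    set F : ℝ → ℝ := fun x => Real.exp (a * x) * (w x t * wxx x t - wx x t ^ 2 / 2
      - a * (w x t * wx x t) + a ^ 2 * w x t ^ 2 / 2 + (1 + v x t) * w x t ^ 2 / 2) with hF
    set F' : ℝ → ℝ := fun x => Real.exp (a * x) * (w x t * wxxx x t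
      + (1 + v x t) * (w x t * wx x t) - 3 / 2 * a * wx x t ^ 2
      + (a ^ 3 + a * (1 + v x t) + vx x t) * w x t ^ 2 / 2) with hF'
    have cF' : Continuous F' := by
      have h1 := sv t
      have h2 := svx t
      have h3 := sw t
      have h4 := swx t
      have h5 := swxxx t
      fun_prop
    have dF : ∀ x, HasDerivAt F (F' x) x := by
      intro x
      have e : HasDerivAt (fun x => Real.exp (a * x)) (Real.exp (a * x) * (a * 1)) x :=
        ((hasDerivAt_id x).const_mul a).exp
      have := e.mul ((((((dw x t).mul (dwxx x t)).sub (((dwx x t).pow 2).div_const 2)).sub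
        (((dw x t).mul (dwx x t)).const_mul a)).add
        ((((dw x t).pow 2).const_mul (a ^ 2)).div_const 2)).add
        ((((dv x t).const_add 1).mul ((dw x t).pow 2)).div_const 2))
      refine this.congr_deriv ?_
      simp [hF']
      ring
    have hint : ∫ x in (0:ℝ)..L, F' x = F L - F 0 :=
      intervalIntegral.integral_eq_sub_of_hasDerivAt (fun x _ => dF x)
        (cF'.intervalIntegrable _ _)
    obtain ⟨b1, b2, b3⟩ := hb t ht
    have hFL : 0 ≤ F L := by
      have hv := (abs_le.1 (hM L ⟨hL.le, le_rfl⟩ t ht)).1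
      have : F L = Real.exp (a * L) * ((a ^ 2 + 1 + v L t) * w L t ^ 2 / 2) := by
        simp only [hF, b2, b3]; ring
      rw [this]
      have : 0 ≤ a ^ 2 + 1 + v L t := by nlinarith
      positivity
    have hF0 : F 0 ≤ 0 := by
      have : F 0 = - (wx 0 t ^ 2 / 2) := by
        simp only [hF, b1]; simp
      rw [this]
      have := sq_nonneg (wx 0 t)
      linarith
    have hle : (∫ x in (0:ℝ)..L, Real.exp (a * x) * (2 * w x t * wt x t)) ≤
        ∫ x in (0:ℝ)..L, (2 * C * (Real.exp (a * x) * w x t ^ 2) - 2 * F' x) := by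
      have h3 := sw t
      have h4 := swt t
      refine intervalIntegral.integral_mono_on hL.le
        ((by fun_prop : Continuous _).intervalIntegrable _ _)
        ((by fun_prop : Continuous _).intervalIntegrable _ _) ?_
      intro x hx
      have hwt : wt x t = - (wx x t + wxxx x t + (w x t * ux x t + v x t * wx x t)) := by
        linarith [heq x hx t ht]
      have hc := (abs_le.1 (hC x hx t ht)).2
      have hep := Real.exp_pos (a * x)
      have e1 : 2 * C * (Real.exp (a * x) * w x t ^ 2) - 2 * F' x
          - Real.exp (a * x) * (2 * w x t * wt x t) =
          2 * (Real.exp (a * x) * w x t ^ 2 *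
            (C - ((a ^ 3 + a * (1 + v x t) + vx x t) / 2 - ux x t)))
          + 3 * a * (Real.exp (a * x) * wx x t ^ 2) := by
        rw [hwt]; simp only [hF']; ring
      have p1 : 0 ≤ Real.exp (a * x) * w x t ^ 2 *
            (C - ((a ^ 3 + a * (1 + v x t) + vx x t) / 2 - ux x t)) :=
        mul_nonneg (by positivity) (by linarith)
      have p2 : 0 ≤ 3 * a * (Real.exp (a * x) * wx x t ^ 2) := by positivity
      linarith
    have hsplit : ∫ x in (0:ℝ)..L, (2 * C * (Real.exp (a * x) * w x t ^ 2) - 2 * F' x)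
        = 2 * C * E t - 2 * (F L - F 0) := by
      have h3 := sw t
      rw [intervalIntegral.integral_sub ((by fun_prop : Continuous _).intervalIntegrable _ _)
        ((by fun_prop : Continuous _).intervalIntegrable _ _),
        intervalIntegral.integral_const_mul, intervalIntegral.integral_const_mul, hint]
    linarith
  have E0 : E 0 = 0 := by
    simp only [hE]
    rw [intervalIntegral.integral_congr (g := fun _ => (0:ℝ))]
    · simp
    · intro x hx
      rw [uIcc_of_le hL.le] at hx
      simp [h0 x hx]
  have dG : ∀ t, HasDerivAt (fun t => Real.exp (-(2 * C) * t) * E t)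
      (Real.exp (-(2 * C) * t) * ((∫ x in (0:ℝ)..L, Real.exp (a * x) * (2 * w x t * wt x t))
        - 2 * C * E t)) t := by
    intro t
    have e : HasDerivAt (fun x => Real.exp (-(2 * C) * x))
        (Real.exp (-(2 * C) * t) * (-(2 * C) * 1)) t :=
      ((hasDerivAt_id t).const_mul (-(2 * C))).exp
    refine (e.mul (dE t)).congr_deriv ?_
    ring
  have anti : AntitoneOn (fun t => Real.exp (-(2 * C) * t) * E t) (Icc 0 T) := by
    refine antitoneOn_of_deriv_nonpos (convex_Icc _ _)
      (fun t _ => (dG t).continuousAt.continuousWithinAt)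
      (fun t _ => (dG t).differentiableAt.differentiableWithinAt) ?_
    intro t ht
    rw [(dG t).deriv]
    exact mul_nonpos_of_nonneg_of_nonpos (Real.exp_pos _).le
      (by linarith [key t (interior_subset ht)])
  intro x hx t ht
  by_contra hne
  have hpos : 0 < E t := by
    have h3 := sw t
    refine intervalIntegral.integral_pos hL
      (by fun_prop : Continuous fun x => Real.exp (a * x) * w x t ^ 2).continuousOn
      (fun y _ => by positivity) ⟨x, hx, by positivity⟩
  have h := anti ⟨le_rfl, ht.1.trans ht.2⟩ ht ht.1
  simp only [E0, mul_zero] at h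
  have := mul_pos (Real.exp_pos (-(2 * C) * t)) hpos
  linarith

theorem uniqueness_smooth_solutions_kdv_ibvp
    (L T : ℝ) (hL : 0 < L) (hT : 0 < T)
    (u v : ℝ → ℝ → ℝ)
    (hu : ContDiff ℝ (⊤ : ℕ∞) (Function.uncurry u))
    (hv : ContDiff ℝ (⊤ : ℕ∞) (Function.uncurry v))
    (hequ : ∀ x ∈ Icc (0:ℝ) L, ∀ t ∈ Icc (0:ℝ) T,
      deriv (fun s => u x s) t + deriv (fun y => u y t) x
        + iteratedDeriv 3 (fun y => u y t) x
        + u x t * deriv (fun y => u y t) x = 0)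
    (heqv : ∀ x ∈ Icc (0:ℝ) L, ∀ t ∈ Icc (0:ℝ) T,
      deriv (fun s => v x s) t + deriv (fun y => v y t) x
        + iteratedDeriv 3 (fun y => v y t) x
        + v x t * deriv (fun y => v y t) x = 0)
    (hinit : ∀ x ∈ Icc (0:ℝ) L, u x 0 = v x 0)
    (hbc : ∀ t ∈ Icc (0:ℝ) T,
      u 0 t = v 0 t ∧ deriv (fun y => u y t) L = deriv (fun y => v y t) L
        ∧ iteratedDeriv 2 (fun y => u y t) L = iteratedDeriv 2 (fun y => v y t) L) :
    ∀ x ∈ Icc (0:ℝ) L, ∀ t ∈ Icc (0:ℝ) T, u x t = v x t := by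
  have it2 : ∀ f f1 f2 : ℝ → ℝ → ℝ, (∀ x t, HasDerivAt (fun y => f y t) (f1 x t) x) →
      (∀ x t, HasDerivAt (fun y => f1 y t) (f2 x t) x) →
      ∀ t, iteratedDeriv 2 (fun y => f y t) = fun x => f2 x t := by
    intro f f1 f2 h1 h2 t
    have e1 : deriv (fun y => f y t) = fun x => f1 x t := funext fun x => (h1 x t).deriv
    have e2 : deriv (fun y => f1 y t) = fun x => f2 x t := funext fun x => (h2 x t).deriv
    rw [iteratedDeriv_succ, iteratedDeriv_one, e1, e2]
  have it3 : ∀ f f1 f2 f3 : ℝ → ℝ → ℝ, (∀ x t, HasDerivAt (fun y => f y t) (f1 x t) x) →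
      (∀ x t, HasDerivAt (fun y => f1 y t) (f2 x t) x) →
      (∀ x t, HasDerivAt (fun y => f2 y t) (f3 x t) x) →
      ∀ t, iteratedDeriv 3 (fun y => f y t) = fun x => f3 x t := by
    intro f f1 f2 f3 h1 h2 h3 t
    rw [iteratedDeriv_succ, it2 f f1 f2 h1 h2 t]
    exact funext fun x => (h3 x t).deriv
  obtain ⟨u1, su1, du1⟩ := kdv_partial_x u hu
  obtain ⟨u2, su2, du2⟩ := kdv_partial_x u1 su1
  obtain ⟨u3, su3, du3⟩ := kdv_partial_x u2 su2
  obtain ⟨ut, sut, dut⟩ := kdv_partial_t u hu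
  obtain ⟨v1, sv1, dv1⟩ := kdv_partial_x v hv
  obtain ⟨v2, sv2, dv2⟩ := kdv_partial_x v1 sv1
  obtain ⟨v3, sv3, dv3⟩ := kdv_partial_x v2 sv2
  obtain ⟨vt, svt, dvt⟩ := kdv_partial_t v hv
  have hw := kdv_core L T hL v u1 v1 (fun x t => u x t - v x t) (fun x t => u1 x t - v1 x t)
    (fun x t => u2 x t - v2 x t) (fun x t => u3 x t - v3 x t) (fun x t => ut x t - vt x t)
    hv.continuous su1.continuous sv1.continuous (hu.continuous.sub hv.continuous)
    (su1.continuous.sub sv1.continuous) (su2.continuous.sub sv2.continuous)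
    (su3.continuous.sub sv3.continuous) (sut.continuous.sub svt.continuous)
    dv1 (fun x t => (du1 x t).sub (dv1 x t)) (fun x t => (du2 x t).sub (dv2 x t))
    (fun x t => (du3 x t).sub (dv3 x t)) (fun x t => (dut x t).sub (dvt x t))
    (by
      intro x hx t ht
      have h1 := hequ x hx t ht
      have h2 := heqv x hx t ht
      rw [it3 u u1 u2 u3 du1 du2 du3 t, (dut x t).deriv, (du1 x t).deriv] at h1
      rw [it3 v v1 v2 v3 dv1 dv2 dv3 t, (dvt x t).deriv, (dv1 x t).deriv] at h2
      linear_combination h1 - h2)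
    (fun x hx => sub_eq_zero.2 (hinit x hx))
    (by
      intro t ht
      obtain ⟨b1, b2, b3⟩ := hbc t ht
      rw [(du1 L t).deriv, (dv1 L t).deriv] at b2
      rw [it2 u u1 u2 du1 du2 t, it2 v v1 v2 dv1 dv2 t] at b3
      exact ⟨sub_eq_zero.2 b1, sub_eq_zero.2 b2, sub_eq_zero.2 b3⟩)
  exact fun x hx t ht => sub_eq_zero.1 (hw x hx t ht)
end

section
/- Let L > 0, T > 0 and let v, a, f : ℝ × ℝ → ℝ be smooth functions such that v_t + v_x + v_xxx + (a v)_x = f on [0,L] × [0,T] and v(0,t) = 0, v_x(L,t) = 0, v_xx(L,t) = 0 for all t ∈ [0,T]. Then for every t ∈ [0,T], (d/dt) ∫₀^L v(x,t)² dx + ( 1 + a(L,t) ) v(L,t)² + v_x(0,t)² + ∫₀^L a_x(x,t) v(x,t)² dx = 2 ∫₀^L f(x,t) v(x,t) dx. -/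
open MeasureTheory Set

lemma aux_deriv_t (v : ℝ → ℝ → ℝ) (hv : ContDiff ℝ (⊤ : ℕ∞) (Function.uncurry v)) :
    Continuous (fun p : ℝ × ℝ => deriv (fun s => v p.1 s) p.2) := by
  have h : (fun p : ℝ × ℝ => deriv (fun s => v p.1 s) p.2)
      = fun p => fderiv ℝ (Function.uncurry v) p (0, 1) := by
    funext p
    have h1 : HasFDerivAt (Function.uncurry v) (fderiv ℝ (Function.uncurry v) p) (p.1, p.2) :=
      (hv.differentiable (by simp) p).hasFDerivAt
    have h2 : HasDerivAt (fun s : ℝ => (p.1, s)) ((0 : ℝ), (1 : ℝ)) p.2 :=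
      (hasDerivAt_const p.2 p.1).prodMk (hasDerivAt_id p.2)
    exact (h1.comp_hasDerivAt p.2 h2).deriv
  rw [h]
  exact (hv.continuous_fderiv (by simp)).clm_apply continuous_const

lemma aux_param (L : ℝ) (v : ℝ → ℝ → ℝ)
    (hv : ContDiff ℝ (⊤ : ℕ∞) (Function.uncurry v)) (t : ℝ) :
    deriv (fun s => ∫ x in (0:ℝ)..L, (v x s)^2) t
      = ∫ x in (0:ℝ)..L, 2 * v x t * deriv (fun s => v x s) t := by
  have hc : Continuous (fun p : ℝ × ℝ => 2 * v p.1 p.2 * deriv (fun s => v p.1 s) p.2) :=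
    (continuous_const.mul hv.continuous).mul (aux_deriv_t v hv)
  have hvc : Continuous (fun p : ℝ × ℝ => v p.1 p.2) := hv.continuous
  obtain ⟨C, hC⟩ := (isCompact_uIcc.prod (isCompact_Icc (a := t - 1) (b := t + 1))
    : IsCompact (uIcc (0:ℝ) L ×ˢ Icc (t-1) (t+1))).exists_bound_of_continuousOn hc.continuousOn
  refine (intervalIntegral.hasDerivAt_integral_of_dominated_loc_of_deriv_le
    (F := fun s x => (v x s)^2)
    (F' := fun s x => 2 * v x s * deriv (fun s => v x s) s)
    (s := Icc (t-1) (t+1)) (bound := fun _ => C)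
    (Icc_mem_nhds (by linarith) (by linarith)) ?_ ?_ ?_ ?_ ?_ ?_).2.deriv
  · refine Filter.Eventually.of_forall fun s => ?_
    exact ((hvc.comp (by fun_prop : Continuous fun x : ℝ => (x, s))).pow 2).aestronglyMeasurable
  · exact ((hvc.comp (by fun_prop : Continuous fun x : ℝ => (x, t))).pow 2).intervalIntegrable _ _
  · exact (hc.comp (by fun_prop : Continuous fun x : ℝ => (x, t))).aestronglyMeasurable
  · refine Filter.Eventually.of_forall fun x hx s hs => ?_
    exact hC (x, s) ⟨uIoc_subset_uIcc hx, hs⟩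
  · exact intervalIntegrable_const
  · refine Filter.Eventually.of_forall fun x hx s hs => ?_
    have h1 : ContDiff ℝ (⊤ : ℕ∞) (fun s => v x s) :=
      hv.comp (contDiff_const.prodMk contDiff_id)
    have h2 := ((h1.differentiable (by simp) s).hasDerivAt.pow 2)
    exact h2.congr_deriv (by simp)

theorem energy_identity_linear_kdv_variable_coefficient
    (L T : ℝ) (hL : 0 < L) (hT : 0 < T)
    (v a f : ℝ → ℝ → ℝ)
    (hv : ContDiff ℝ (⊤ : ℕ∞) (Function.uncurry v))
    (ha : ContDiff ℝ (⊤ : ℕ∞) (Function.uncurry a))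
    (hf : ContDiff ℝ (⊤ : ℕ∞) (Function.uncurry f))
    (heq : ∀ x ∈ Icc (0:ℝ) L, ∀ t ∈ Icc (0:ℝ) T,
      deriv (fun s => v x s) t + deriv (fun y => v y t) x
        + iteratedDeriv 3 (fun y => v y t) x
        + deriv (fun y => a y t * v y t) x = f x t)
    (hbc : ∀ t ∈ Icc (0:ℝ) T,
      v 0 t = 0 ∧ deriv (fun y => v y t) L = 0
        ∧ iteratedDeriv 2 (fun y => v y t) L = 0) :
    ∀ t ∈ Icc (0:ℝ) T,
      deriv (fun s => ∫ x in (0:ℝ)..L, (v x s)^2) t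
        + (1 + a L t) * (v L t)^2 + (deriv (fun y => v y t) 0)^2
        + (∫ x in (0:ℝ)..L, deriv (fun y => a y t) x * (v x t)^2)
      = 2 * ∫ x in (0:ℝ)..L, f x t * v x t := by
  intro t ht
  obtain ⟨b0, b1, b2⟩ := hbc t ht
  rw [aux_param L v hv t]
  have hvt : Continuous (fun x : ℝ => 2 * v x t * deriv (fun s => v x s) t) := by
    have hc : Continuous (fun p : ℝ × ℝ => 2 * v p.1 p.2 * deriv (fun s => v p.1 s) p.2) :=
      (continuous_const.mul hv.continuous).mul (aux_deriv_t v hv)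
    exact hc.comp (by fun_prop : Continuous fun x : ℝ => (x, t))
  have hw : ContDiff ℝ (⊤ : ℕ∞) (fun y => v y t) := hv.comp (contDiff_id.prodMk contDiff_const)
  have hα : ContDiff ℝ (⊤ : ℕ∞) (fun y => a y t) := ha.comp (contDiff_id.prodMk contDiff_const)
  have hφ : ContDiff ℝ (⊤ : ℕ∞) (fun y => f y t) := hf.comp (contDiff_id.prodMk contDiff_const)
  have e : ∀ x ∈ Icc (0:ℝ) L, 2 * v x t * deriv (fun s => v x s) t
      = 2 * (f x t * v x t) - 2 * v x t * (deriv (fun y => v y t) x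
        + iteratedDeriv 3 (fun y => v y t) x + deriv (fun y => a y t * v y t) x) := by
    intro x hx
    linear_combination (2 * v x t) * heq x hx t ht
  have d0 : ∀ x, HasDerivAt (fun y => v y t) (deriv (fun y => v y t) x) x :=
    fun x => (hw.differentiable (by simp) x).hasDerivAt
  have dα : ∀ x, HasDerivAt (fun y => a y t) (deriv (fun y => a y t) x) x :=
    fun x => (hα.differentiable (by simp) x).hasDerivAt
  have dk : ∀ (k : ℕ) x, HasDerivAt (iteratedDeriv k (fun y => v y t))
      (iteratedDeriv (k+1) (fun y => v y t) x) x := by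
    intro k x
    rw [iteratedDeriv_succ]
    exact (hw.differentiable_iteratedDeriv k (by exact_mod_cast ENat.natCast_lt_top k) x).hasDerivAt
  have d1 := dk 1
  have d2 := dk 2
  rw [iteratedDeriv_one] at d1
  have hprod : ∀ x, deriv (fun y => a y t * v y t) x
      = deriv (fun y => a y t) x * v x t + a x t * deriv (fun y => v y t) x :=
    fun x => ((dα x).mul (d0 x)).deriv
  have cα : Continuous (deriv (fun y => a y t)) := hα.continuous_deriv (by simp)
  have hi1 : IntervalIntegrable (fun x => 2 * v x t * deriv (fun s => v x s) t) volume 0 L :=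
    hvt.intervalIntegrable _ _
  have hi2 : IntervalIntegrable (fun x => deriv (fun y => a y t) x * (v x t)^2) volume 0 L :=
    (cα.mul (hw.continuous.pow 2)).intervalIntegrable _ _
  have hi3 : IntervalIntegrable (fun x => 2 * (f x t * v x t)) volume 0 L :=
    (continuous_const.mul (hφ.continuous.mul hw.continuous)).intervalIntegrable _ _
  have key := intervalIntegral.integral_eq_sub_of_hasDerivAt (a := 0) (b := L)
    (f := fun x => (v x t)^2 + 2 * (v x t * iteratedDeriv 2 (fun y => v y t) x)
      - (deriv (fun y => v y t) x)^2 + a x t * (v x t)^2)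
    (f' := fun x => 2 * (f x t * v x t) - 2 * v x t * deriv (fun s => v x s) t
      - deriv (fun y => a y t) x * (v x t)^2) ?_ ((hi3.sub hi1).sub hi2)
  · rw [intervalIntegral.integral_sub (hi3.sub hi1) hi2, intervalIntegral.integral_sub hi3 hi1,
      intervalIntegral.integral_const_mul] at key
    simp only [b0, b1, b2] at key
    linear_combination -key
  · intro x hx
    rw [uIcc_of_le hL.le] at hx
    have h := ((((d0 x).pow 2).add (((d0 x).mul (d2 x)).const_mul 2)).sub ((d1 x).pow 2)).add
      ((dα x).mul ((d0 x).pow 2))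
    refine h.congr_deriv ?_
    have e1 := e x hx
    rw [hprod] at e1
    simp only [Pi.pow_apply]
    push_cast
    linear_combination e1
end
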